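/- Let V ⊆ ℝ≥0^n be a tropical cone with V ≠ {0} and V ≠ ℝ≥0^n. Then V is a conical hemispace if and only if there exist a nonempty proper subset I of {1,…,n}, with J := {1,…,n} \ I, and an admissible family (σ⁻_{ij})_{i∈I, j∈J} satisfying the rank-one condition, such that V = cone({e^i ⊕ λ·e^j : i ∈ I, j ∈ J, λ ∈ σ⁻_{ij}}) (every λ belonging to some σ⁻_{ij} lies in ℝ≥0). -/

import Mathlib

open scoped NNReal

/-- A set in `ℝ≥0^n` is tropically convex (max-times model). -/
def TropConvex {n : ℕ} (C : Set (Fin n → ℝ≥0)) : Prop :=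
  ∀ x ∈ C, ∀ y ∈ C, ∀ α β : ℝ≥0, max α β = 1 →
    (fun i => max (α * x i) (β * y i)) ∈ C

/-- A tropical cone: a nonempty set closed under coordinatewise max and scalar multiplication. -/
def TropCone {n : ℕ} (V : Set (Fin n → ℝ≥0)) : Prop :=
  V.Nonempty ∧ (∀ x ∈ V, ∀ y ∈ V, (fun i => max (x i) (y i)) ∈ V) ∧
    ∀ x ∈ V, ∀ lam : ℝ≥0, (fun i => lam * x i) ∈ V

/-- Support of a vector. -/
def supp {n : ℕ} (x : Fin n → ℝ≥0) : Set (Fin n) := {i | x i ≠ 0}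

/-- Quasisector of type `i` at `y`. -/
def quasiSector {n : ℕ} (y : Fin n → ℝ≥0) (i : Fin n) : Set (Fin n → ℝ≥0) :=
  {x | (∀ j ∈ supp y, x j * y i ≤ x i * y j) ∧ ∀ j ∉ supp y, x j = 0}


/-- Sector of type `i ∈ supp y` at `y`. -/
def sector {n : ℕ} (y : Fin n → ℝ≥0) (i : Fin n) : Set (Fin n → ℝ≥0) :=
  {x | (∀ j ∈ supp y, x j * y i ≤ x i * y j) ∧ y i ≤ x i ∧ ∀ j ∉ supp y, x j = 0}

/-- Sector of type `n+1` at `y`. -/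
def sectorTop {n : ℕ} (y : Fin n → ℝ≥0) : Set (Fin n → ℝ≥0) :=
  {x | ∀ j, x j ≤ y j}

/-- The `i`-th unit vector. -/
def unitVec {n : ℕ} (i : Fin n) : Fin n → ℝ≥0 := fun k => if k = i then 1 else 0

/-- The vector `e^i ⊕ λ e^j` (i-th coordinate `max 1 (λ·[i=j])`, j-th coordinate `λ`). -/
def duet {n : ℕ} (i j : Fin n) (lam : ℝ≥0) : Fin n → ℝ≥0 :=
  fun k => max (unitVec i k) (lam * unitVec j k)

/-- Tropical linear span (cone generated by `R`): all finite tropical linear combinations. -/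
def tropSpan {n : ℕ} (R : Set (Fin n → ℝ≥0)) : Set (Fin n → ℝ≥0) :=
  {x | ∃ (m : ℕ) (r : Fin m → Fin n → ℝ≥0) (l : Fin m → ℝ≥0),
    (∀ k, r k ∈ R) ∧ x = fun i => Finset.univ.sup fun k => l k * r k i}

/-- Tropical convex hull: all finite tropical convex combinations. -/
def tropConv {n : ℕ} (P : Set (Fin n → ℝ≥0)) : Set (Fin n → ℝ≥0) :=
  {x | ∃ (m : ℕ) (p : Fin m → Fin n → ℝ≥0) (l : Fin m → ℝ≥0),
    (∀ k, p k ∈ P) ∧ Finset.univ.sup l = 1 ∧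
    x = fun i => Finset.univ.sup fun k => l k * p k i}

/-- Tropical Minkowski sum of two sets. -/
def tropMink {n : ℕ} (A B : Set (Fin n → ℝ≥0)) : Set (Fin n → ℝ≥0) :=
  {z | ∃ a ∈ A, ∃ b ∈ B, z = fun i => max (a i) (b i)}

open scoped ENNReal Pointwise

/-- A conical hemispace: a tropical cone whose complement, enlarged with `0`, is also a
tropical cone. -/
def IsConicalHemispace {n : ℕ} (V : Set (Fin n → ℝ≥0)) : Prop :=
  TropCone V ∧ ∃ V2 : Set (Fin n → ℝ≥0), TropCone V2 ∧ V ∩ V2 = {0} ∧ V ∪ V2 = Set.univ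

/-- An admissible boundary set: a nonempty proper subset of `[0,∞]` of the form
`{λ ∈ ℝ≥0 | λ ≤ s}` or `{λ ∈ ℝ≥0 | λ < s}` for some `s ∈ [0,∞]`. -/
def AdmissibleSet (S : Set ℝ≥0∞) : Prop :=
  S.Nonempty ∧ S ≠ Set.univ ∧
    ∃ s : ℝ≥0∞, S = {l | l ≠ ⊤ ∧ l ≤ s} ∨ S = {l | l ≠ ⊤ ∧ l < s}

/-- The vector `e^i ⊕ λ e^j` for `λ ∈ [0,∞]`, with the convention `e^i ⊕ (+∞)·e^j := e^j`. -/
noncomputable def duetE {n : ℕ} (i j : Fin n) (lam : ℝ≥0∞) : Fin n → ℝ≥0 :=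
  if lam = ⊤ then unitVec j else duet i j lam.toNNReal

section TropicalCones

variable {n : ℕ}

lemma TropCone.zero_mem {V : Set (Fin n → ℝ≥0)} (hV : TropCone V) : (0 : Fin n → ℝ≥0) ∈ V := by
  obtain ⟨x, hx⟩ := hV.1
  have h := hV.2.2 x hx 0
  simp only [zero_mul] at h
  exact h

lemma TropCone.sup_mem {V : Set (Fin n → ℝ≥0)} (hV : TropCone V) {ι : Type*} (s : Finset ι)
    (r : ι → Fin n → ℝ≥0) (hr : ∀ k ∈ s, r k ∈ V) : (fun i => s.sup fun k => r k i) ∈ V := by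
  classical
  induction s using Finset.induction_on with
  | empty =>
    simp only [Finset.sup_empty]
    exact hV.zero_mem
  | insert a s _ ih =>
    simp only [Finset.sup_insert]
    exact hV.2.1 _ (hr a (Finset.mem_insert_self a s)) _
      (ih fun k hk => hr k (Finset.mem_insert_of_mem hk))

lemma TropCone.tropSpan_subset {V R : Set (Fin n → ℝ≥0)} (hV : TropCone V) (hR : R ⊆ V) :
    tropSpan R ⊆ V := by
  rintro x ⟨m, r, l, hr, rfl⟩
  exact hV.sup_mem Finset.univ (fun k i => l k * r k i) fun k _ => hV.2.2 _ (hR (hr k)) _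

lemma TropCone.eq_univ_of_unitVec_mem {V : Set (Fin n → ℝ≥0)} (hV : TropCone V)
    (h : ∀ i, unitVec i ∈ V) : V = Set.univ := by
  refine Set.eq_univ_of_forall fun x => ?_
  have hx := hV.sup_mem Finset.univ (fun k i => x k * unitVec k i) fun k _ => hV.2.2 _ (h k) _
  convert hx using 2 with i
  refine le_antisymm ?_ (Finset.sup_le fun k _ => ?_)
  · exact le_trans (by simp [unitVec]) (Finset.le_sup (Finset.mem_univ i))
  · by_cases hik : i = k <;> simp [unitVec, hik]

lemma duetE_coe (i j : Fin n) (μ : ℝ≥0) : duetE i j (μ : ℝ≥0∞) = duet i j μ := by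
  simp [duetE]

lemma duetE_zero (i j : Fin n) : duetE i j 0 = unitVec i := by
  funext k
  simp [duetE, duet]

lemma duetE_top (i j : Fin n) : duetE i j ⊤ = unitVec j := by
  simp [duetE]

lemma AdmissibleSet.zero_mem {S : Set ℝ≥0∞} (hS : AdmissibleSet S) : 0 ∈ S := by
  obtain ⟨⟨x, hx⟩, -, s, rfl | rfl⟩ := hS
  · simp
  · exact ⟨by simp, lt_of_le_of_lt bot_le hx.2⟩

lemma AdmissibleSet.top_notMem {S : Set ℝ≥0∞} (hS : AdmissibleSet S) : ⊤ ∉ S := by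
  obtain ⟨-, -, s, rfl | rfl⟩ := hS <;> simp

lemma AdmissibleSet.mem_of_le {S : Set ℝ≥0∞} (hS : AdmissibleSet S) {a b : ℝ≥0∞} (h : a ≤ b)
    (hb : b ∈ S) : a ∈ S := by
  obtain ⟨-, -, s, rfl | rfl⟩ := hS
  · exact ⟨ne_top_of_le_ne_top hb.1 h, h.trans hb.2⟩
  · exact ⟨ne_top_of_le_ne_top hb.1 h, h.trans_lt hb.2⟩

lemma admissibleSet_of_isLowerSet {S : Set ℝ≥0∞} (h0 : 0 ∈ S) (htop : ⊤ ∉ S)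
    (hS : ∀ a b, a ≤ b → b ∈ S → a ∈ S) : AdmissibleSet S := by
  refine ⟨⟨0, h0⟩, fun h => htop (h ▸ Set.mem_univ _), sSup S, ?_⟩
  have hne : ∀ l ∈ S, l ≠ ⊤ := fun l hl h => htop (h ▸ hl)
  by_cases hs : sSup S ∈ S
  · left
    ext l
    exact ⟨fun hl => ⟨hne l hl, le_sSup hl⟩, fun hl => hS _ _ hl.2 hs⟩
  · right
    ext l
    refine ⟨fun hl => ⟨hne l hl, lt_of_le_of_ne (le_sSup hl) ?_⟩, fun hl => ?_⟩
    · rintro rfl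
      exact hs hl
    · obtain ⟨b, hb, hlb⟩ := lt_sSup_iff.1 hl.2
      exact hS _ _ hlb.le hb

/-- The vectors each of whose nonzero `J`-coordinates is dominated by some `I`-coordinate,
where `J` is the complement of `I` and the admissible ratios are prescribed by `σ`. -/
def ratioCone (I : Set (Fin n)) (σ : Fin n → Fin n → Set ℝ≥0∞) : Set (Fin n → ℝ≥0) :=
  {x | ∀ j ∉ I, x j ≠ 0 → ∃ i ∈ I, (x j : ℝ≥0∞) / x i ∈ σ i j}

/-- The vectors each of whose nonzero `I`-coordinates has a ratio outside `σ` with some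
`J`-coordinate, where `J` is the complement of `I`. -/
def coRatioCone (I : Set (Fin n)) (σ : Fin n → Fin n → Set ℝ≥0∞) : Set (Fin n → ℝ≥0) :=
  {x | ∀ i ∈ I, x i ≠ 0 → ∃ j ∉ I, (x j : ℝ≥0∞) / x i ∉ σ i j}

lemma coe_smul_div_smul {l : ℝ≥0} (hl : l ≠ 0) (a b : ℝ≥0) :
    ((l * a : ℝ≥0) : ℝ≥0∞) / ((l * b : ℝ≥0) : ℝ≥0∞) = (a : ℝ≥0∞) / b := by
  rw [ENNReal.coe_mul, ENNReal.coe_mul]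
  exact ENNReal.mul_div_mul_left _ _ (by simpa using hl) ENNReal.coe_ne_top

lemma div_max_le_div (a b c : ℝ≥0) : (a : ℝ≥0∞) / (max b c : ℝ≥0) ≤ (a : ℝ≥0∞) / b := by
  gcongr
  exact le_max_left b c

lemma div_le_max_div (a b c : ℝ≥0) : (a : ℝ≥0∞) / c ≤ ((max a b : ℝ≥0) : ℝ≥0∞) / c := by
  gcongr
  exact le_max_left a b

variable {I : Set (Fin n)} {σ : Fin n → Fin n → Set ℝ≥0∞}

lemma tropCone_ratioCone (hσ : ∀ i ∈ I, ∀ j ∉ I, AdmissibleSet (σ i j)) :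
    TropCone (ratioCone I σ) := by
  have key : ∀ x ∈ ratioCone I σ, ∀ (y : Fin n → ℝ≥0), ∀ j ∉ I, y j ≤ x j → max (x j) (y j) ≠ 0 →
      ∃ i ∈ I, ((max (x j) (y j) : ℝ≥0) : ℝ≥0∞) / (max (x i) (y i) : ℝ≥0) ∈ σ i j := by
    intro x hx y j hj hle hne
    rw [max_eq_left hle] at hne ⊢
    obtain ⟨i, hi, hmem⟩ := hx j hj hne
    exact ⟨i, hi, (hσ i hi j hj).mem_of_le (div_max_le_div _ _ _) hmem⟩
  refine ⟨⟨0, fun j _ h => absurd rfl h⟩, fun x hx y hy j hj hne => ?_, fun x hx l j hj hne => ?_⟩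
  · rcases le_total (y j) (x j) with h | h
    · exact key x hx y j hj h hne
    · simp only [max_comm (x _)] at hne ⊢
      exact key y hy x j hj h hne
  · have hl : l ≠ 0 := left_ne_zero_of_mul hne
    simp only [coe_smul_div_smul hl]
    exact hx j hj (right_ne_zero_of_mul hne)

lemma tropCone_coRatioCone (hσ : ∀ i ∈ I, ∀ j ∉ I, AdmissibleSet (σ i j)) :
    TropCone (coRatioCone I σ) := by
  have key : ∀ x ∈ coRatioCone I σ, ∀ (y : Fin n → ℝ≥0), ∀ i ∈ I, y i ≤ x i →
      max (x i) (y i) ≠ 0 →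
      ∃ j ∉ I, ((max (x j) (y j) : ℝ≥0) : ℝ≥0∞) / (max (x i) (y i) : ℝ≥0) ∉ σ i j := by
    intro x hx y i hi hle hne
    rw [max_eq_left hle] at hne ⊢
    obtain ⟨j, hj, hmem⟩ := hx i hi hne
    exact ⟨j, hj, fun h => hmem ((hσ i hi j hj).mem_of_le (div_le_max_div _ _ _) h)⟩
  refine ⟨⟨0, fun j _ h => absurd rfl h⟩, fun x hx y hy i hi hne => ?_, fun x hx l i hi hne => ?_⟩
  · rcases le_total (y i) (x i) with h | h
    · exact key x hx y i hi h hne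
    · simp only [max_comm (x _)] at hne ⊢
      exact key y hy x i hi h hne
  · have hl : l ≠ 0 := left_ne_zero_of_mul hne
    simp only [coe_smul_div_smul hl]
    exact hx i hi (right_ne_zero_of_mul hne)

lemma ratioCone_union_coRatioCone : ratioCone I σ ∪ coRatioCone I σ = Set.univ := by
  refine Set.eq_univ_of_forall fun x => ?_
  by_contra hx
  simp only [Set.mem_union, not_or, ratioCone, coRatioCone, Set.mem_ofPred_eq, not_forall,
    not_exists, not_and, not_not] at hx
  obtain ⟨⟨j, hj, -, h₁⟩, i, hi, -, h₂⟩ := hx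
  exact h₁ i hi (h₂ j hj)

lemma ratioCone_inter_coRatioCone (hσ : ∀ i ∈ I, ∀ j ∉ I, AdmissibleSet (σ i j))
    (hrank : ∀ i1 ∈ I, ∀ i2 ∈ I, ∀ j1 ∉ I, ∀ j2 ∉ I,
      ((σ i1 j2)ᶜ * (σ i2 j1)ᶜ) ∩ (σ i1 j1 * σ i2 j2) = ∅) :
    ratioCone I σ ∩ coRatioCone I σ = {0} := by
  refine Set.Subset.antisymm ?_ (Set.singleton_subset_iff.2
    ⟨(tropCone_ratioCone hσ).zero_mem, (tropCone_coRatioCone hσ).zero_mem⟩)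
  rintro x ⟨hx₁, hx₂⟩
  by_contra hx0
  have hpos : ∀ i ∈ I, ∀ j ∉ I, x j ≠ 0 → (x j : ℝ≥0∞) / x i ∈ σ i j → x i ≠ 0 := by
    intro i hi j hj hxj hmem hxi
    apply (hσ i hi j hj).top_notMem
    simpa [hxi, ENNReal.div_zero, hxj] using hmem
  obtain ⟨i₀, hi₀, hxi₀⟩ : ∃ i ∈ I, x i ≠ 0 := by
    obtain ⟨k, hk⟩ := Function.ne_iff.1 hx0
    by_cases hkI : k ∈ I
    · exact ⟨k, hkI, hk⟩
    · obtain ⟨i, hi, hmem⟩ := hx₁ k hkI hk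
      exact ⟨i, hi, hpos i hi k hkI hk hmem⟩
  have hcover : ∀ T : Finset (Fin n), (∀ j ∈ T, j ∉ I ∧ x j ≠ 0) →
      ∃ i ∈ I, x i ≠ 0 ∧ ∀ j ∈ T, (x j : ℝ≥0∞) / x i ∈ σ i j := by
    intro T
    induction T using Finset.induction_on with
    | empty => exact fun _ => ⟨i₀, hi₀, hxi₀, by simp⟩
    | insert j T _ ih =>
      intro hT
      obtain ⟨i, hi, hxi, hiT⟩ := ih fun k hk => hT k (Finset.mem_insert_of_mem hk)
      obtain ⟨hj, hxj⟩ := hT j (Finset.mem_insert_self j T)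
      by_cases hij : (x j : ℝ≥0∞) / x i ∈ σ i j
      · refine ⟨i, hi, hxi, fun k hk => ?_⟩
        rcases Finset.mem_insert.1 hk with rfl | hk
        exacts [hij, hiT k hk]
      · obtain ⟨i', hi', hi'j⟩ := hx₁ j hj hxj
        refine ⟨i', hi', hpos i' hi' j hj hxj hi'j, fun k hk => ?_⟩
        rcases Finset.mem_insert.1 hk with rfl | hkT
        · exact hi'j
        · by_contra hi'k
          have hempty := hrank i hi i' hi' k (hT k hk).1 j hj
          refine Set.eq_empty_iff_forall_notMem.1 hempty
            ((x j : ℝ≥0∞) / x i * (x k / x i')) ⟨Set.mul_mem_mul hij hi'k, ?_⟩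
          have hprod : (x j : ℝ≥0∞) / x i * (x k / x i') = x k / x i * (x j / x i') := by
            simp only [div_eq_mul_inv]
            ring
          rw [hprod]
          exact Set.mul_mem_mul (hiT k hkT) hi'j
  classical
  obtain ⟨i, hi, hxi, hall⟩ := hcover (Finset.univ.filter fun j => j ∉ I ∧ x j ≠ 0) (by simp)
  obtain ⟨j, hj, hmem⟩ := hx₂ i hi hxi
  by_cases hxj : x j = 0
  · apply hmem
    simpa [hxj] using (hσ i hi j hj).zero_mem
  · exact hmem (hall j (by simp [hj, hxj]))

lemma ratioCone_subset_tropSpan (hI : I.Nonempty) (hI' : I ≠ Set.univ)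
    (hσ : ∀ i ∈ I, ∀ j ∉ I, AdmissibleSet (σ i j)) :
    ratioCone I σ ⊆ tropSpan {v | ∃ i ∈ I, ∃ j ∉ I, ∃ lam ∈ σ i j, v = duetE i j lam} := by
  intro x hx
  obtain ⟨i₀, hi₀⟩ := hI
  obtain ⟨j₀, hj₀⟩ := (Set.ne_univ_iff_exists_notMem I).1 hI'
  have hgen : ∀ k, ∃ r ∈ {v | ∃ i ∈ I, ∃ j ∉ I, ∃ lam ∈ σ i j, v = duetE i j lam}, ∃ l : ℝ≥0,
      l * r k = x k ∧ ∀ c, l * r c ≤ x c := by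
    intro k
    by_cases hk : k ∈ I
    · refine ⟨unitVec k, ⟨k, hk, j₀, hj₀, 0, (hσ k hk j₀ hj₀).zero_mem, (duetE_zero k j₀).symm⟩,
        x k, by simp [unitVec], fun c => ?_⟩
      by_cases hc : c = k <;> simp [unitVec, hc]
    · by_cases hxk : x k = 0
      · exact ⟨_, ⟨i₀, hi₀, k, hk, 0, (hσ i₀ hi₀ k hk).zero_mem, rfl⟩, 0, by simp [hxk], by simp⟩
      · obtain ⟨i, hi, hmem⟩ := hx k hk hxk
        have hxi : x i ≠ 0 := by
          intro hxi
          apply (hσ i hi k hk).top_notMem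
          simpa [hxi, ENNReal.div_zero, hxk] using hmem
        have hik : k ≠ i := fun h => hk (h ▸ hi)
        rw [← ENNReal.coe_div hxi] at hmem
        refine ⟨_, ⟨i, hi, k, hk, _, hmem, rfl⟩, x i, ?_, fun c => ?_⟩
        · rw [duetE_coe]
          simp [duet, unitVec, hik, mul_div_cancel₀, hxi]
        · rw [duetE_coe]
          by_cases hci : c = i
          · subst hci
            simp [duet, unitVec, hik.symm]
          · by_cases hck : c = k
            · subst hck
              simp [duet, unitVec, hci, mul_div_cancel₀, hxi]
            · simp [duet, unitVec, hci, hck]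
  choose r hr l hl hle using hgen
  refine ⟨n, r, l, hr, funext fun c => le_antisymm ?_ (Finset.sup_le fun k _ => hle k c)⟩
  exact (hl c).ge.trans (Finset.le_sup (f := fun k => l k * r k c) (Finset.mem_univ c))

lemma tropSpan_eq_ratioCone (hI : I.Nonempty) (hI' : I ≠ Set.univ)
    (hσ : ∀ i ∈ I, ∀ j ∉ I, AdmissibleSet (σ i j)) :
    tropSpan {v | ∃ i ∈ I, ∃ j ∉ I, ∃ lam ∈ σ i j, v = duetE i j lam} = ratioCone I σ := by
  refine Set.Subset.antisymm ((tropCone_ratioCone hσ).tropSpan_subset ?_)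
    (ratioCone_subset_tropSpan hI hI' hσ)
  rintro v ⟨i, hi, j, hj, lam, hlam, rfl⟩ k hk hvk
  have htop : lam ≠ ⊤ := fun h => (hσ i hi j hj).top_notMem (h ▸ hlam)
  lift lam to ℝ≥0 using htop
  rw [duetE_coe] at hvk ⊢
  have hki : k ≠ i := fun h => hk (h ▸ hi)
  have hij : i ≠ j := fun h => hj (h ▸ hi)
  by_cases hkj : k = j
  · subst hkj
    refine ⟨i, hi, ?_⟩
    simpa [duet, unitVec, hki, hij] using hlam
  · simp [duet, unitVec, hki, hkj] at hvk

/-- The ratios `λ` for which `e^i ⊕ λ e^j` lies in `V`. -/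
def ratioSet (V : Set (Fin n → ℝ≥0)) (i j : Fin n) : Set ℝ≥0∞ := {l | duetE i j l ∈ V}

lemma admissibleSet_ratioSet {V : Set (Fin n → ℝ≥0)} (hV : TropCone V) {i j : Fin n}
    (hi : unitVec i ∈ V) (hj : unitVec j ∉ V) : AdmissibleSet (ratioSet V i j) := by
  have htop : ⊤ ∉ ratioSet V i j := by simpa [ratioSet, duetE_top] using hj
  refine admissibleSet_of_isLowerSet (by simpa [ratioSet, duetE_zero] using hi) htop ?_
  intro a b hab hb
  lift b to ℝ≥0 using fun h => htop (h ▸ hb)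
  lift a to ℝ≥0 using ne_top_of_le_ne_top ENNReal.coe_ne_top hab
  rw [ENNReal.coe_le_coe] at hab
  rcases eq_or_ne b 0 with rfl | hb0
  · rwa [le_antisymm hab bot_le]
  · have h := hV.2.1 _ hi _ (hV.2.2 _ hb (a / b))
    simp only [ratioSet, Set.mem_ofPred_eq, duetE_coe] at h ⊢
    convert h using 2 with k
    have h₁ : a / b * unitVec i k ≤ unitVec i k :=
      mul_le_of_le_one_left bot_le (div_le_one_of_le₀ hab bot_le)
    simp only [duet]
    rw [mul_max_of_nonneg _ _ zero_le, ← mul_assoc, div_mul_cancel₀ _ hb0, ← max_assoc,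
      max_eq_left h₁]

lemma ratioSet_rank_one {V W : Set (Fin n → ℝ≥0)} (hV : TropCone V) (hW : TropCone W)
    (hVW : V ∩ W = {0}) (hun : V ∪ W = Set.univ) {i1 i2 j1 j2 : Fin n}
    (hi1 : unitVec i1 ∈ V) (hi2 : unitVec i2 ∈ V) (hj1 : unitVec j1 ∉ V) (hj2 : unitVec j2 ∉ V) :
    ((ratioSet V i1 j2)ᶜ * (ratioSet V i2 j1)ᶜ) ∩ (ratioSet V i1 j1 * ratioSet V i2 j2) = ∅ := by
  refine Set.eq_empty_iff_forall_notMem.2 ?_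
  rintro _ ⟨⟨a, ha, b, hb, rfl⟩, c, hc, d, hd, hcd⟩
  simp only at hcd
  have ha0 : a ≠ 0 := fun h => ha (h ▸ (admissibleSet_ratioSet hV hi1 hj2).zero_mem)
  have hb0 : b ≠ 0 := fun h => hb (h ▸ (admissibleSet_ratioSet hV hi2 hj1).zero_mem)
  have hct : c ≠ ⊤ := fun h => (admissibleSet_ratioSet hV hi1 hj1).top_notMem (h ▸ hc)
  have hdt : d ≠ ⊤ := fun h => (admissibleSet_ratioSet hV hi2 hj2).top_notMem (h ▸ hd)
  have hab : a * b ≠ ⊤ := hcd ▸ ENNReal.mul_ne_top hct hdt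
  lift c to ℝ≥0 using hct
  lift d to ℝ≥0 using hdt
  lift a to ℝ≥0 using fun h => hab (by rw [h, ENNReal.top_mul hb0])
  lift b to ℝ≥0 using fun h => hab (by rw [h, ENNReal.mul_top ha0])
  have hb0' : b ≠ 0 := by simpa using hb0
  have hcd' : c * d = a * b := by exact_mod_cast hcd
  have hmemW : ∀ {x}, x ∉ V → x ∈ W := fun {x} hx =>
    ((Set.mem_union _ _ _).1 (hun ▸ Set.mem_univ x)).resolve_left hx
  simp only [ratioSet, Set.mem_compl_iff, Set.mem_ofPred_eq, duetE_coe] at ha hb hc hd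
  have h₁ := hV.2.1 _ hc _ (hV.2.2 _ hd (c / b))
  have h₂ := hW.2.1 _ (hmemW ha) _ (hW.2.2 _ (hmemW hb) (c / b))
  have hx : (fun k => max (duet i1 j1 c k) (c / b * duet i2 j2 d k)) =
      fun k => max (duet i1 j2 a k) (c / b * duet i2 j1 b k) := by
    funext k
    have e₁ : c / b * d = a := by rw [div_mul_eq_mul_div, hcd', mul_div_cancel_right₀ _ hb0']
    have e₂ : c / b * b = c := div_mul_cancel₀ _ hb0'
    simp only [duet, mul_max_of_nonneg _ _ (zero_le (a := c / b)), ← mul_assoc, e₁, e₂]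
    simp only [max_left_comm, max_comm]
  rw [← hx] at h₂
  have h₀ : (fun k => max (duet i1 j1 c k) (c / b * duet i2 j2 d k)) = 0 := hVW.subset ⟨h₁, h₂⟩
  have h := congrFun h₀ i1
  simp [duet, unitVec] at h

lemma subset_ratioCone_ratioSet {V W : Set (Fin n → ℝ≥0)} (hW : TropCone W)
    (hVW : V ∩ W = {0}) (hun : V ∪ W = Set.univ) :
    V ⊆ ratioCone {i | unitVec i ∈ V} (ratioSet V) := by
  intro x hx j hj hxj
  by_contra hcon
  push Not at hcon
  have hmemW : ∀ {x}, x ∉ V → x ∈ W := fun {x} hx =>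
    ((Set.mem_union _ _ _).1 (hun ▸ Set.mem_univ x)).resolve_left hx
  have hgen : ∀ k, ∃ r ∈ W, r k = x k ∧ ∀ c, r c ≤ x c := by
    intro k
    by_cases hk : unitVec k ∈ V ∧ x k ≠ 0
    · obtain ⟨hkV, hxk⟩ := hk
      have h := hcon k hkV
      rw [← ENNReal.coe_div hxk, ratioSet, Set.mem_ofPred_eq, duetE_coe] at h
      have hkj : j ≠ k := fun h => hj (h ▸ hkV)
      refine ⟨_, hW.2.2 _ (hmemW h) (x k), by simp [duet, unitVec, hkj.symm], fun c => ?_⟩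
      by_cases hck : c = k
      · subst hck
        simp [duet, unitVec, hkj.symm]
      · by_cases hcj : c = j
        · subst hcj
          simp [duet, unitVec, hck, mul_div_cancel₀, hxk]
        · simp [duet, unitVec, hck, hcj]
    · by_cases hxk : x k = 0
      · exact ⟨0, hW.zero_mem, by simp [hxk], by simp⟩
      · have hkV : unitVec k ∉ V := fun h => hk ⟨h, hxk⟩
        refine ⟨_, hW.2.2 _ (hmemW hkV) (x k), by simp [unitVec], fun c => ?_⟩
        by_cases hc : c = k <;> simp [unitVec, hc]
  choose r hr hrk hle using hgen
  have hxW : x ∈ W := by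
    convert hW.sup_mem Finset.univ r fun k _ => hr k using 1
    refine funext fun c => le_antisymm ?_ (Finset.sup_le fun k _ => hle k c)
    exact (hrk c).ge.trans (Finset.le_sup (f := fun k => r k c) (Finset.mem_univ c))
  have h₀ : x = 0 := hVW.subset ⟨hx, hxW⟩
  exact hxj (by simp [h₀])

end TropicalCones

theorem stmt13 {n : ℕ} (V : Set (Fin n → ℝ≥0)) (hV : TropCone V)
    (h0 : V ≠ {0}) (huniv : V ≠ Set.univ) :
    IsConicalHemispace V ↔
      ∃ I : Set (Fin n), I.Nonempty ∧ I ≠ Set.univ ∧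
        ∃ σm : Fin n → Fin n → Set ℝ≥0∞,
          (∀ i ∈ I, ∀ j ∉ I, AdmissibleSet (σm i j)) ∧
          (∀ i1 ∈ I, ∀ i2 ∈ I, ∀ j1 ∉ I, ∀ j2 ∉ I,
            ((σm i1 j2)ᶜ * (σm i2 j1)ᶜ) ∩ (σm i1 j1 * σm i2 j2) = ∅ ∧
            (σm i1 j2 * σm i2 j1) ∩ ((σm i1 j1)ᶜ * (σm i2 j2)ᶜ) = ∅) ∧
          V = tropSpan {v | ∃ i ∈ I, ∃ j ∉ I, ∃ lam ∈ σm i j, v = duetE i j lam} := by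
  constructor
  · rintro ⟨-, W, hW, hVW, hun⟩
    have hI : {i | unitVec i ∈ V}.Nonempty := by
      by_contra hemp
      have hWuniv : W = Set.univ := hW.eq_univ_of_unitVec_mem fun i =>
        ((Set.mem_union _ _ _).1 (hun ▸ Set.mem_univ (unitVec i))).resolve_left
          fun h => hemp ⟨i, h⟩
      exact h0 (by rwa [hWuniv, Set.inter_univ] at hVW)
    have hI' : {i : Fin n | unitVec i ∈ V} ≠ Set.univ := fun h =>
      huniv (hV.eq_univ_of_unitVec_mem (Set.eq_univ_iff_forall.1 h))
    have hσ : ∀ i ∈ {i | unitVec i ∈ V}, ∀ j ∉ {i | unitVec i ∈ V},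
        AdmissibleSet (ratioSet V i j) := fun i hi j hj => admissibleSet_ratioSet hV hi hj
    refine ⟨_, hI, hI', ratioSet V, hσ, fun i1 hi1 i2 hi2 j1 hj1 j2 hj2 => ⟨?_, ?_⟩, ?_⟩
    · exact ratioSet_rank_one hV hW hVW hun hi1 hi2 hj1 hj2
    · rw [Set.inter_comm]
      exact ratioSet_rank_one hV hW hVW hun hi1 hi2 hj2 hj1
    · refine Set.Subset.antisymm ((subset_ratioCone_ratioSet hW hVW hun).trans
        (ratioCone_subset_tropSpan hI hI' hσ)) (hV.tropSpan_subset ?_)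
      rintro _ ⟨i, -, j, -, lam, hlam, rfl⟩
      exact hlam
  · rintro ⟨I, hI, hI', σ, hσ, hrank, hspan⟩
    rw [tropSpan_eq_ratioCone hI hI' hσ] at hspan
    refine ⟨hV, coRatioCone I σ, tropCone_coRatioCone hσ, ?_, ?_⟩
    · rw [hspan]
      exact ratioCone_inter_coRatioCone hσ fun i1 hi1 i2 hi2 j1 hj1 j2 hj2 =>
        (hrank i1 hi1 i2 hi2 j1 hj1 j2 hj2).1
    · rw [hspan]
      exact ratioCone_union_coRatioCone
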